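/- Fix k ≥ 1, complex mixing weights λ_1, …, λ_k, each nonzero, and complex numbers m̄_1, …, m̄_{k+1}. Let S ⊆ ℂ^{k+1} be the set of tuples (μ_1, …, μ_k, s) satisfying the k+1 moment equations Σ_{ℓ=1}^k λ_ℓ · M_i(μ_ℓ, s) = m̄_i for i = 1, …, k+1. If S is finite, then the cardinality of S is at most (k+1)!/2. -/

import Mathlib

/-- The Gaussian moment polynomials: `M 0 = 1`, `M 1 = μ`,
and `M i = μ * M (i-1) + (i-1) * v * M (i-2)` for `i ≥ 2`. -/
noncomputable def gaussMoment {α : Type*} [CommRing α] : ℕ → α → α → α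
  | 0, _, _ => 1
  | 1, μ, _ => μ
  | (n + 2), μ, v => μ * gaussMoment (n + 1) μ v + ((n : α) + 1) * v * gaussMoment n μ v

open MvPolynomial

instance finite_degree_lt (σ : Type*) [Finite σ] (N : ℕ) :
    Finite {a : σ →₀ ℕ // a.degree < N} := by
  have := Fintype.ofFinite σ
  refine Finite.of_injective
    (fun a : {a : σ →₀ ℕ // a.degree < N} ↦ fun i ↦
      (⟨a.1 i, (Finsupp.le_degree i a.1).trans_lt a.2⟩ : Fin N)) fun a b h ↦ ?_
  ext i
  simpa using congrFun h i

/-- The number of monomials of degree less than `N` in the variables `σ`. -/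
noncomputable def monomialCount (σ : Type*) (N : ℕ) : ℕ :=
  Nat.card {a : σ →₀ ℕ // a.degree < N}

lemma monomialCount_mono (σ : Type*) [Finite σ] : Monotone (monomialCount σ) := fun _ _ h ↦
  Nat.card_le_card_of_injective (fun a ↦ ⟨a.1, a.2.trans_le h⟩) fun _ _ hab ↦
    Subtype.ext (Subtype.mk.inj hab)

lemma monomialCount_congr {σ τ : Type*} [Fintype σ] [Fintype τ] (e : σ ≃ τ) (N : ℕ) :
    monomialCount σ N = monomialCount τ N :=
  Nat.card_congr <| (Finsupp.domCongr e).toEquiv.subtypeEquiv fun a ↦ by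
    simp [Finsupp.degree_eq_sum, Equiv.sum_comp e.symm a]

lemma monomialCount_le_pow (σ : Type*) [Fintype σ] (N : ℕ) :
    monomialCount σ N ≤ N ^ Fintype.card σ := by
  have h := Nat.card_le_card_of_injective
    (fun a : {a : σ →₀ ℕ // a.degree < N} ↦ fun i ↦
      (⟨a.1 i, (Finsupp.le_degree i a.1).trans_lt a.2⟩ : Fin N)) fun a b h ↦ by
        ext i
        simpa using congrFun h i
  simpa [monomialCount, Nat.card_fun] using h

/-- Since `monomialCount σ` grows polynomially, shifting its argument does not change its
leading coefficient. -/
lemma le_of_mul_monomialCount_le (σ : Type*) [Finite σ] {A B c : ℕ}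
    (h : ∀ N, A * monomialCount σ N ≤ B * monomialCount σ (N + c)) : A ≤ B := by
  have := Fintype.ofFinite σ
  by_contra! hAB
  have hone : 1 ≤ monomialCount σ 1 :=
    Nat.card_pos_iff.2 ⟨⟨⟨0, by simp⟩⟩, inferInstance⟩
  have key (t : ℕ) : (B + 1) ^ t ≤ B ^ t * monomialCount σ (1 + t * c) := by
    induction t with
    | zero => simpa using hone
    | succ t ih =>
      calc (B + 1) ^ (t + 1) = (B + 1) * (B + 1) ^ t := pow_succ' _ _
        _ ≤ A * (B ^ t * monomialCount σ (1 + t * c)) := Nat.mul_le_mul hAB ih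
        _ = B ^ t * (A * monomialCount σ (1 + t * c)) := mul_left_comm _ _ _
        _ ≤ B ^ t * (B * monomialCount σ (1 + t * c + c)) := Nat.mul_le_mul_left _ (h _)
        _ = _ := by rw [pow_succ, mul_assoc]; congr 3; ring
  have hr : |(B / (B + 1) : ℝ)| < 1 := by
    rw [abs_of_nonneg (by positivity), div_lt_one (by positivity)]; linarith
  have hlim := (tendsto_pow_const_mul_const_pow_of_abs_lt_one (Fintype.card σ) hr).const_mul
    (((1 + c : ℕ) : ℝ) ^ Fintype.card σ)
  rw [mul_zero] at hlim
  obtain ⟨t, ht, ht1⟩ :=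
    ((hlim.eventually (gt_mem_nhds one_pos)).and (Filter.eventually_ge_atTop 1)).exists
  have hle : (B + 1) ^ t ≤ B ^ t * ((1 + c) * t) ^ Fintype.card σ :=
    (key t).trans <| by
      gcongr
      refine (monomialCount_le_pow σ _).trans ?_
      gcongr
      nlinarith
  have hle' : ((B : ℝ) + 1) ^ t ≤ B ^ t * ((1 + c) * t) ^ Fintype.card σ := by exact_mod_cast hle
  rw [div_pow] at ht
  have hpos : (0 : ℝ) < ((B : ℝ) + 1) ^ t := by positivity
  have : ((1 + c : ℕ) : ℝ) ^ Fintype.card σ * ((t : ℝ) ^ Fintype.card σ * (B ^ t / (B + 1) ^ t))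
      = (B ^ t * ((1 + c) * t) ^ Fintype.card σ) / (B + 1) ^ t := by
    push_cast; rw [mul_pow]; ring
  rw [this, div_lt_one hpos] at ht
  linarith

/-- Dividing exponents by `d` with remainder compares degrees with degrees weighted by `d`. -/
lemma monomialCount_le_prod_mul (ι : Type*) [Fintype ι] (d : ι → ℕ) (hd : ∀ i, 0 < d i) (N : ℕ) :
    Finite {a : ι →₀ ℕ // ∑ i, a i * d i < N} ∧
    monomialCount ι N ≤ (∏ i, d i) * Nat.card {a : ι →₀ ℕ // ∑ i, a i * d i < N} := by
  have hfin : Finite {a : ι →₀ ℕ // ∑ i, a i * d i < N} :=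
    Finite.of_injective (β := {a : ι →₀ ℕ // a.degree < N})
      (fun a ↦ ⟨a.1, by
        refine lt_of_le_of_lt ?_ a.2
        rw [Finsupp.degree_eq_sum]
        exact Finset.sum_le_sum fun i _ ↦ Nat.le_mul_of_pos_right _ (hd i)⟩)
      fun a b h ↦ Subtype.ext (Subtype.mk.inj h)
  refine ⟨hfin, ?_⟩
  have h := Nat.card_le_card_of_injective
    (β := (∀ i, Fin (d i)) × {a : ι →₀ ℕ // ∑ i, a i * d i < N})
    (fun a : {a : ι →₀ ℕ // a.degree < N} ↦
      (fun i ↦ ⟨a.1 i % d i, Nat.mod_lt _ (hd i)⟩,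
        ⟨Finsupp.equivFunOnFinite.symm fun i ↦ a.1 i / d i, by
          refine lt_of_le_of_lt ?_ a.2
          rw [Finsupp.degree_eq_sum]
          exact Finset.sum_le_sum fun i _ ↦ by simpa using Nat.div_mul_le_self _ _⟩))
    fun a b h ↦ by
      simp only [Prod.mk.injEq, Subtype.mk.injEq, EmbeddingLike.apply_eq_iff_eq] at h
      ext i
      rw [← Nat.mod_add_div (a.1 i) (d i), ← Nat.mod_add_div (b.1 i) (d i),
        Fin.mk.inj (congrFun h.1 i),
        congrFun h.2 i]
  simpa [monomialCount, Nat.card_pi] using h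

section Truncation

variable {ι K : Type*} [Field K]

/-- The coefficients of a polynomial in degrees less than `N`. -/
noncomputable def truncCoeff (ι K : Type*) [Field K] (N : ℕ) :
    MvPolynomial ι K →ₗ[K] ({a : ι →₀ ℕ // a.degree < N} → K) :=
  LinearMap.pi fun a ↦ lcoeff K a.1

lemma truncCoeff_eq_zero_iff (N : ℕ) (p : MvPolynomial ι K) :
    truncCoeff ι K N p = 0 ↔ p ∈ idealOfVars ι K ^ N := by
  simp [truncCoeff, mem_pow_idealOfVars_iff', _root_.funext_iff]

lemma truncCoeff_surjective [Finite ι] (N : ℕ) : Function.Surjective (truncCoeff ι K N) := by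
  classical
  have := Fintype.ofFinite {a : ι →₀ ℕ // a.degree < N}
  intro f
  refine ⟨∑ a, monomial a.1 (f a), _root_.funext fun b ↦ ?_⟩
  simp [truncCoeff, coeff_monomial, Subtype.coe_inj]

lemma finrank_truncCoeff [Finite ι] (N : ℕ) :
    Module.finrank K ({a : ι →₀ ℕ // a.degree < N} → K) = monomialCount ι N := by
  have := Fintype.ofFinite {a : ι →₀ ℕ // a.degree < N}
  rw [Module.finrank_pi, ← Nat.card_eq_fintype_card, monomialCount]

/-- Multiplication by a nonzero polynomial lowers the order of vanishing at the origin by a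
bounded amount. -/
lemma exists_mem_pow_idealOfVars_of_mul_mem {c : MvPolynomial ι K} (hc : c ≠ 0) :
    ∃ m : ℕ, ∀ N g, c * g ∈ idealOfVars ι K ^ (N + m) → g ∈ idealOfVars ι K ^ N := by
  have horder (p : MvPolynomial ι K) (n : ℕ) :
      p ∈ idealOfVars ι K ^ n ↔ (n : ℕ∞) ≤ (p : MvPowerSeries ι K).order := by
    rw [mem_pow_idealOfVars_iff']
    refine ⟨fun h ↦ MvPowerSeries.nat_le_order fun d hd ↦ by simpa using h d hd, fun h d hd ↦ ?_⟩
    simpa using MvPowerSeries.coeff_of_lt_order (lt_of_lt_of_le (by exact_mod_cast hd) h)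
  have hc' : (c : MvPowerSeries ι K) ≠ 0 := by simpa using hc
  have hm := MvPowerSeries.ne_zero_iff_order_finite.1 hc'
  refine ⟨(c : MvPowerSeries ι K).order.toNat, fun N g h ↦ ?_⟩
  rw [horder, coe_mul, MvPowerSeries.order_mul, ← hm, Nat.cast_add, add_comm] at h
  rw [horder]
  exact (ENat.add_le_add_iff_left (ENat.natCast_ne_top _)).1 h

/-- A linear section of a surjective map restricted to a complement of a subspace. -/
lemma exists_complement_lift {V W : Type*} [AddCommGroup V] [Module K V] [AddCommGroup W]
    [Module K W] [Module.Finite K W] (f : V →ₗ[K] W) (hf : Function.Surjective f)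
    (Q : Submodule K W) : ∃ T : Submodule K V, Module.Finite K T ∧
      Module.finrank K T + Module.finrank K Q ≤ Module.finrank K W ∧
      ∀ v, ∃ t ∈ T, f (v - t) ∈ Q := by
  obtain ⟨C, hC⟩ := Q.exists_isCompl
  obtain ⟨g, hg⟩ := f.exists_rightInverse_of_surjective (LinearMap.range_eq_top.2 hf)
  refine ⟨C.map g, inferInstance, ?_, fun v ↦ ?_⟩
  · rw [← Submodule.finrank_add_eq_of_isCompl hC, add_comm]
    gcongr
    exact Submodule.finrank_map_le g C
  · obtain ⟨q, hq, t, ht, hqt⟩ := Submodule.mem_sup.1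
      (hC.sup_eq_top ▸ Submodule.mem_top : f v ∈ Q ⊔ C)
    refine ⟨g t, Submodule.mem_map_of_mem ht, ?_⟩
    have : f (g t) = t := LinearMap.congr_fun hg t
    rw [map_sub, this, ← hqt, add_sub_cancel_right]
    exact hq

/-- Polynomials modulo a nonzero `c` and modulo high order terms have small dimension. -/
lemma exists_complement_mul [Finite ι] {c : MvPolynomial ι K} {m : ℕ}
    (hm : ∀ N g, c * g ∈ idealOfVars ι K ^ (N + m) → g ∈ idealOfVars ι K ^ N) (N : ℕ) :
    ∃ T : Submodule K (MvPolynomial ι K), Module.Finite K T ∧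
      Module.finrank K T + monomialCount ι N ≤ monomialCount ι (N + m) ∧
      ∀ g, ∃ t ∈ T, ∃ h, g - t - c * h ∈ idealOfVars ι K ^ (N + m) := by
  let f := truncCoeff ι K (N + m)
  let μ := f ∘ₗ LinearMap.mulLeft K c
  obtain ⟨T, hfin, hT, hspan⟩ := exists_complement_lift f (truncCoeff_surjective _) μ.range
  refine ⟨T, hfin, ?_, fun g ↦ ?_⟩
  · rw [finrank_truncCoeff] at hT
    refine le_trans ?_ hT
    gcongr
    obtain ⟨s, hs⟩ := (truncCoeff ι K N).exists_rightInverse_of_surjective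
      (LinearMap.range_eq_top.2 (truncCoeff_surjective _))
    rw [← finrank_truncCoeff (K := K)]
    refine LinearMap.finrank_le_finrank_of_injective (f := μ.rangeRestrict ∘ₗ s) ?_
    rw [← LinearMap.ker_eq_bot, LinearMap.ker_eq_bot']
    intro x hx
    have h0 : f (c * s x) = 0 := congrArg Subtype.val hx
    have hsx := (truncCoeff_eq_zero_iff _ _).2 (hm N _ ((truncCoeff_eq_zero_iff _ _).1 h0))
    exact (LinearMap.congr_fun hs x).symm.trans hsx
  · obtain ⟨t, ht, h, hh⟩ := hspan g
    refine ⟨t, ht, h, (truncCoeff_eq_zero_iff _ _).1 ?_⟩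
    rw [map_sub, ← hh]
    exact sub_self _

end Truncation

lemma sup_pow_smul_top_eq_top {R M : Type*} [CommRing R] [AddCommGroup M] [Module R M]
    {I : Ideal R} {Q : Submodule R M} (h : Q ⊔ I • ⊤ = ⊤) (N : ℕ) : Q ⊔ I ^ N • ⊤ = ⊤ := by
  induction N with
  | zero => simp
  | succ N ih =>
    rw [eq_top_iff]
    calc ⊤ = Q ⊔ I • (Q ⊔ I ^ N • ⊤) := by rw [ih, h]
      _ = Q ⊔ I • Q ⊔ I ^ (N + 1) • ⊤ := by
        rw [Submodule.smul_sup, ← Submodule.mul_smul, ← pow_succ', sup_assoc]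
      _ ≤ Q ⊔ I ^ (N + 1) • ⊤ := sup_le_sup_right (sup_le le_rfl Submodule.smul_le_right) _

lemma exists_linearIndepOn_smul_mem_span {R M κ : Type*} [CommRing R] [IsDomain R]
    [AddCommGroup M] [Module R M] [Finite κ] (b : κ → M) :
    ∃ s : Set κ, LinearIndepOn R b s ∧
      ∃ c : R, c ≠ 0 ∧ ∀ i, c • b i ∈ Submodule.span R (b '' s) := by
  classical
  have := Fintype.ofFinite κ
  obtain ⟨s, hs, h⟩ := exists_maximal_linearIndepOn R b
  have h' (i : κ) : ∃ a : R, a ≠ 0 ∧ a • b i ∈ Submodule.span R (b '' s) := by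
    by_cases hi : i ∈ s
    · exact ⟨1, one_ne_zero, by
        rw [one_smul]; exact Submodule.subset_span (Set.mem_image_of_mem b hi)⟩
    · exact h i hi
  choose a ha hab using h'
  refine ⟨s, hs, ∏ i, a i, Finset.prod_ne_zero_iff.2 fun i _ ↦ ha i, fun i ↦ ?_⟩
  rw [← Finset.prod_erase_mul _ _ (Finset.mem_univ i), mul_smul]
  exact Submodule.smul_mem _ _ (hab i)

/-- A bound for the dimension of a space onto which a module over a polynomial ring maps with
`idealOfVars ^ (N + m)` acting as zero, in terms of generators and of a
maximal independent subset of them. -/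
lemma finrank_add_le_of_span_sup_eq_top {ι K M A κ : Type*} [Finite ι] [Field K]
    [AddCommGroup M] [Module K M] [Module (MvPolynomial ι K) M]
    [IsScalarTower K (MvPolynomial ι K) M] [AddCommGroup A] [Module K A] [Fintype κ] {b : κ → M}
    (hb : Submodule.span (MvPolynomial ι K) (Set.range b) ⊔ idealOfVars ι K • ⊤ = ⊤)
    {s : Set κ} {c : MvPolynomial ι K}
    (hc : ∀ i, c • b i ∈ Submodule.span (MvPolynomial ι K) (b '' s)) {m : ℕ}
    (hm : ∀ N g, c * g ∈ idealOfVars ι K ^ (N + m) → g ∈ idealOfVars ι K ^ N) (N : ℕ)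
    (π : M →ₗ[K] A) (hπ : Function.Surjective π)
    (hπ0 : ∀ g ∈ idealOfVars ι K ^ (N + m), ∀ x, π (g • x) = 0) :
    Module.finrank K A + Fintype.card κ * monomialCount ι N ≤
      (Nat.card s + Fintype.card κ) * monomialCount ι (N + m) := by
  classical
  have := Fintype.ofFinite s
  obtain ⟨T, hTfin, hT, hTspan⟩ := exists_complement_mul hm N
  obtain ⟨W, hWfin, hW, hWspan⟩ :=
    exists_complement_lift (truncCoeff ι K (N + m)) (truncCoeff_surjective _) ⊥
  rw [finrank_truncCoeff, finrank_bot, add_zero] at hW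
  let Φ : (κ → T) × (s → W) →ₗ[K] A :=
    π ∘ₗ LinearMap.coprod
      (∑ i, (LinearMap.toSpanSingleton (MvPolynomial ι K) M (b i)).restrictScalars K ∘ₗ
        T.subtype ∘ₗ LinearMap.proj i)
      (∑ j : s, (LinearMap.toSpanSingleton (MvPolynomial ι K) M (b j)).restrictScalars K ∘ₗ
        W.subtype ∘ₗ LinearMap.proj j)
  have hΦ : Function.Surjective Φ := by
    intro a
    obtain ⟨x, rfl⟩ := hπ a
    obtain ⟨y, hy, z, hz, rfl⟩ := Submodule.mem_sup.1
      (sup_pow_smul_top_eq_top hb (N + m) ▸ Submodule.mem_top : x ∈ _)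
    have hz0 : π z = 0 := by
      refine Submodule.smul_induction_on hz (fun r hr n _ ↦ hπ0 r hr n) fun u v hu hv ↦ ?_
      rw [map_add, hu, hv, add_zero]
    obtain ⟨g, rfl⟩ := (Submodule.mem_span_range_iff_exists_fun _).1 hy
    choose t ht h hth using fun i ↦ hTspan (g i)
    have hmem : ∑ i, h i • c • b i ∈ Submodule.span (MvPolynomial ι K) (b '' s) :=
      Submodule.sum_mem _ fun i _ ↦ Submodule.smul_mem _ _ (hc i)
    rw [Set.image_eq_range] at hmem
    obtain ⟨u, hu⟩ := (Submodule.mem_span_range_iff_exists_fun _).1 hmem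
    choose w hw hwu using fun j ↦ hWspan (u j)
    refine ⟨(fun i ↦ ⟨t i, ht i⟩, fun j ↦ ⟨w j, hw j⟩), ?_⟩
    have hΦ' : Φ (fun i ↦ ⟨t i, ht i⟩, fun j ↦ ⟨w j, hw j⟩) =
        π (∑ i, t i • b i) + π (∑ j, w j • b j) := by
      simp [Φ]
    have hwπ : π (∑ j, w j • b j) = π (∑ i, h i • c • b i) := by
      rw [← hu, ← sub_eq_zero, ← map_sub, ← Finset.sum_sub_distrib, map_sum]
      refine Finset.sum_eq_zero fun j _ ↦ ?_
      rw [← sub_smul, ← neg_sub, neg_smul, map_neg,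
        hπ0 _ ((truncCoeff_eq_zero_iff _ _).1 (hwu j)), neg_zero]
    rw [hΦ', hwπ, map_add, hz0, add_zero, ← map_add, ← Finset.sum_add_distrib, eq_comm,
      ← sub_eq_zero, ← map_sub, ← Finset.sum_sub_distrib, map_sum]
    refine Finset.sum_eq_zero fun i _ ↦ ?_
    rw [smul_smul, ← add_smul, ← sub_smul, ← sub_sub, mul_comm, hπ0 _ (hth i)]
  have h1 := LinearMap.finrank_le_finrank_of_surjective hΦ
  rw [Module.finrank_prod, Module.finrank_pi_fintype, Module.finrank_pi_fintype] at h1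
  simp only [Finset.sum_const, Finset.card_univ, smul_eq_mul] at h1
  rw [Nat.card_eq_fintype_card]
  have h2 := Nat.mul_le_mul_left (Fintype.card κ) hT
  have h3 := Nat.mul_le_mul_left (Fintype.card s) hW
  linarith

section Bezout

variable {ι σ K : Type*} [Field K]

lemma finrank_restrictSupport_degree_lt (N : ℕ) :
    Module.finrank K (restrictSupport K {a : σ →₀ ℕ | a.degree < N}) = monomialCount σ N :=
  Module.finrank_eq_nat_card_basis (basisRestrictSupport K _)

/-- Polynomials which are linearly independent over a polynomial subring generated by
polynomials of degrees at most `d i` are at most `∏ i, d i` in number. -/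
lemma card_le_prod_of_linearIndependent [Fintype ι] [Fintype σ] {κ : Type*} [Finite κ]
    [Algebra (MvPolynomial ι K) (MvPolynomial σ K)]
    [IsScalarTower K (MvPolynomial ι K) (MvPolynomial σ K)] (e : ι ≃ σ)
    {d : ι → ℕ} (hd : ∀ i, 0 < d i)
    (hF : ∀ i, (algebraMap (MvPolynomial ι K) (MvPolynomial σ K) (X i)).totalDegree ≤ d i)
    {b : κ → MvPolynomial σ K} (hb : LinearIndependent (MvPolynomial ι K) b) :
    Nat.card κ ≤ ∏ i, d i := by
  have := Fintype.ofFinite κ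
  have hdeg (a : ι →₀ ℕ) : (algebraMap (MvPolynomial ι K) (MvPolynomial σ K)
      (monomial a 1)).totalDegree ≤ ∑ i, a i * d i := by
    rw [monomial_eq, C_1, one_mul, Finsupp.prod_fintype _ _ (by simp), map_prod]
    refine (totalDegree_finsetProd _ _).trans (Finset.sum_le_sum fun i _ ↦ ?_)
    rw [map_pow]
    exact (totalDegree_pow _ _).trans (Nat.mul_le_mul_left _ (hF i))
  refine le_of_mul_monomialCount_le ι (c := Finset.univ.sup fun j ↦ (b j).totalDegree) fun N ↦ ?_
  set E := Finset.univ.sup fun j ↦ (b j).totalDegree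
  obtain ⟨hfin, hN⟩ := monomialCount_le_prod_mul ι d hd N
  have := Fintype.ofFinite {a : ι →₀ ℕ // ∑ i, a i * d i < N}
  have hli := linearIndependent_smul ((basisMonomials ι K).linearIndependent.comp
    (Subtype.val : {a : ι →₀ ℕ // ∑ i, a i * d i < N} → _) Subtype.val_injective) hb
  have : Finite {a : σ →₀ ℕ | a.degree < N + E} := finite_degree_lt σ (N + E)
  have := Module.Finite.of_basis (basisRestrictSupport K {a : σ →₀ ℕ | a.degree < N + E})
  have hmem (q : {a : ι →₀ ℕ // ∑ i, a i * d i < N} × κ) :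
      ((basisMonomials ι K ∘ Subtype.val) q.1 : MvPolynomial ι K) • b q.2 ∈
        restrictSupport K {a : σ →₀ ℕ | a.degree < N + E} := by
    rw [mem_restrictSupport_iff]
    intro x hx
    refine (le_totalDegree hx).trans_lt ?_
    rw [Function.comp_apply, coe_basisMonomials, Algebra.smul_def]
    refine (totalDegree_mul _ _).trans_lt ?_
    exact add_lt_add_of_lt_of_le ((hdeg _).trans_lt q.1.2)
      (Finset.le_sup (f := fun j ↦ (b j).totalDegree) (Finset.mem_univ q.2))
  have hle := Submodule.finrank_mono (Submodule.span_le.2 (Set.range_subset_iff.2 hmem))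
  rw [finrank_span_eq_card hli, finrank_restrictSupport_degree_lt, Fintype.card_prod,
    ← Nat.card_eq_fintype_card, ← Nat.card_eq_fintype_card] at hle
  rw [monomialCount_congr e (N + E)]
  calc Nat.card κ * monomialCount ι N ≤ Nat.card κ * ((∏ i, d i) * _) :=
        Nat.mul_le_mul_left _ hN
    _ = (∏ i, d i) * (Nat.card {a : ι →₀ ℕ // ∑ i, a i * d i < N} * Nat.card κ) := by ring
    _ ≤ _ := Nat.mul_le_mul_left _ hle

lemma mem_idealOfVars_iff (p : MvPolynomial σ K) : p ∈ idealOfVars σ K ↔ constantCoeff p = 0 := by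
  rw [← pow_one (idealOfVars σ K), mem_pow_idealOfVars_iff']
  simp [constantCoeff_eq, Finsupp.degree_eq_zero_iff]

/-- Substitution of `X + z` for `X`. -/
noncomputable def shiftVars (z : σ → K) : MvPolynomial σ K →ₐ[K] MvPolynomial σ K :=
  aeval fun i ↦ X i + C (z i)

lemma shiftVars_surjective [Finite σ] (z : σ → K) : Function.Surjective (shiftVars z) := fun p ↦ by
  refine ⟨shiftVars (-z) p, ?_⟩
  suffices (shiftVars z).comp (shiftVars (-z)) = AlgHom.id K _ from DFunLike.congr_fun this p
  ext i
  simp [shiftVars]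

lemma constantCoeff_shiftVars (z : σ → K) (p : MvPolynomial σ K) :
    constantCoeff (shiftVars z p) = eval z p := by
  suffices constantCoeff.comp (shiftVars z : MvPolynomial σ K →+* MvPolynomial σ K) = eval z from
    DFunLike.congr_fun this p
  ext i <;> simp [shiftVars]

/-- The Taylor coefficients at finitely many distinct points, in degrees less than `N`. -/
noncomputable def taylorCoeff {ζ : Type*} (z : ζ → σ → K) (N : ℕ) :
    MvPolynomial σ K →ₗ[K] (ζ → {a : σ →₀ ℕ // a.degree < N} → K) :=
  LinearMap.pi fun j ↦ truncCoeff σ K N ∘ₗ (shiftVars (z j)).toLinearMap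

lemma taylorCoeff_surjective [Finite σ] {ζ : Type*} [Finite ζ] {z : ζ → σ → K}
    (hz : Function.Injective z)
    (N : ℕ) : Function.Surjective (taylorCoeff z N) := by
  let I (j : ζ) : Ideal (MvPolynomial σ K) := (idealOfVars σ K).comap (shiftVars (z j))
  have hI : Pairwise (Function.onFun IsCoprime fun j ↦ I j ^ N) := by
    intro j l hjl
    refine IsCoprime.pow ?_
    obtain ⟨i, hi⟩ := Function.ne_iff.1 (hz.ne hjl)
    have hmem (j : ζ) : X i - C (z j i) ∈ I j := by
      simp [I, mem_idealOfVars_iff, constantCoeff_shiftVars]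
    rw [Ideal.isCoprime_iff_sup_eq, Ideal.eq_top_iff_one]
    have hsub : C (z j i - z l i) ∈ I j ⊔ I l := by
      have := sub_mem (Ideal.mem_sup_right (S := I j) (hmem l)) (Ideal.mem_sup_left (hmem j))
      rwa [sub_sub_sub_cancel_left, ← C_sub] at this
    have := Ideal.mul_mem_left _ (C (z j i - z l i)⁻¹) hsub
    rwa [← C_mul, inv_mul_cancel₀ (sub_ne_zero.2 hi), C_1] at this
  intro f
  choose g hg using fun j ↦ truncCoeff_surjective N (f j)
  choose h hh using fun j ↦ shiftVars_surjective (z j) (g j)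
  obtain ⟨r, hr⟩ := Ideal.exists_forall_sub_mem_ideal hI h
  refine ⟨r, _root_.funext fun j ↦ ?_⟩
  have h1 : shiftVars (z j) (r - h j) ∈ idealOfVars σ K ^ N :=
    Ideal.le_comap_pow (shiftVars (z j)) N (hr j)
  rw [← truncCoeff_eq_zero_iff, map_sub, map_sub, hh, hg, sub_eq_zero] at h1
  exact h1

lemma taylorCoeff_smul_eq_zero {ζ : Type*} [Algebra (MvPolynomial ι K) (MvPolynomial σ K)]
    {z : ζ → σ → K}
    (hz : ∀ j i, eval (z j) (algebraMap (MvPolynomial ι K) (MvPolynomial σ K) (X i)) = 0)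
    {N : ℕ} {g : MvPolynomial ι K} (hg : g ∈ idealOfVars ι K ^ N) (x : MvPolynomial σ K) :
    taylorCoeff z N (g • x) = 0 := by
  refine _root_.funext fun j ↦ (truncCoeff_eq_zero_iff _ _).2 ?_
  let ψ := (shiftVars (z j) : MvPolynomial σ K →+* MvPolynomial σ K).comp
    (algebraMap (MvPolynomial ι K) _)
  have hle : idealOfVars ι K ≤ (idealOfVars σ K).comap ψ := by
    rw [idealOfVars, Ideal.span_le, Set.range_subset_iff]
    intro i
    simp [ψ, mem_idealOfVars_iff, constantCoeff_shiftVars, hz]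
  rw [Algebra.smul_def]
  change shiftVars (z j) _ ∈ _
  rw [map_mul]
  exact Ideal.mul_mem_right _ _ (Ideal.le_comap_pow ψ N (Ideal.pow_right_mono hle N hg))

lemma module_finite_quotient_of_finite_zeroLocus [Finite σ] [IsAlgClosed K]
    {I : Ideal (MvPolynomial σ K)}
    (hI : (zeroLocus K I).Finite) : Module.Finite K (MvPolynomial σ K ⧸ I) := by
  have hX (i : σ) : IsIntegral K (Ideal.Quotient.mk I (X i)) := by
    let q : Polynomial K := ∏ z ∈ hI.toFinset, (Polynomial.X - Polynomial.C (z i))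
    have hq : q.Monic := Polynomial.monic_prod_of_monic _ _ fun z _ ↦ Polynomial.monic_X_sub_C _
    have hmem : Polynomial.aeval (X i : MvPolynomial σ K) q ∈ I.radical := by
      rw [← vanishingIdeal_zeroLocus_eq_radical (K := K), mem_vanishingIdeal_iff]
      intro z hz
      rw [map_prod, map_prod]
      exact Finset.prod_eq_zero (hI.mem_toFinset.2 hz) (by simp)
    obtain ⟨L, hL⟩ := hmem
    refine ⟨q ^ L, hq.pow L, ?_⟩
    rw [← Polynomial.aeval_def, ← Ideal.Quotient.mkₐ_eq_mk K, Polynomial.aeval_algHom_apply,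
      map_pow, Ideal.Quotient.mkₐ_eq_mk, Ideal.Quotient.eq_zero_iff_mem]
    exact hL
  have : Algebra.IsIntegral K (MvPolynomial σ K ⧸ I) := ⟨fun x ↦ by
    obtain ⟨p, rfl⟩ := Ideal.Quotient.mk_surjective x
    induction p using MvPolynomial.induction_on with
    | C a => exact isIntegral_algebraMap
    | add p q hp hq => rw [map_add]; exact hp.add hq
    | mul_X p i hp => rw [map_mul]; exact hp.mul (hX i)⟩
  exact Algebra.IsIntegral.finite

/-- **Bézout's inequality**: a square polynomial system over an algebraically closed field
with finitely many solutions has at most as many solutions as the product of the degrees. -/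
theorem ncard_zeros_le_prod [Fintype ι] [Fintype σ] [IsAlgClosed K] (e : ι ≃ σ)
    (F : ι → MvPolynomial σ K) {d : ι → ℕ}
    (hd : ∀ i, 0 < d i) (hF : ∀ i, (F i).totalDegree ≤ d i)
    (hfin : {z : σ → K | ∀ i, eval z (F i) = 0}.Finite) :
    {z : σ → K | ∀ i, eval z (F i) = 0}.ncard ≤ ∏ i, d i := by
  set Z := {z : σ → K | ∀ i, eval z (F i) = 0}
  have := hfin.fintype
  let _ : Algebra (MvPolynomial ι K) (MvPolynomial σ K) :=
    (aeval F : MvPolynomial ι K →ₐ[K] MvPolynomial σ K).toAlgebra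
  have hmap (p) : algebraMap (MvPolynomial ι K) (MvPolynomial σ K) p = aeval F p := rfl
  have : IsScalarTower K (MvPolynomial ι K) (MvPolynomial σ K) :=
    .of_algebraMap_eq fun x ↦ by simp [hmap, algebraMap_eq]
  have hmapX (i : ι) : algebraMap (MvPolynomial ι K) (MvPolynomial σ K) (X i) = F i := by
    simp [hmap]
  let I := Ideal.span (Set.range F)
  have hZ : zeroLocus K I = Z := by
    simp [I, zeroLocus_span, Z, aeval_eq_eval]
  have := module_finite_quotient_of_finite_zeroLocus (hZ ▸ hfin)
  obtain ⟨n, v, hv⟩ := Module.Finite.exists_fin (R := K) (M := MvPolynomial σ K ⧸ I)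
  choose b hb using fun i ↦ Ideal.Quotient.mk_surjective (v i)
  have hI (x : MvPolynomial σ K) (hx : x ∈ I) :
      x ∈ idealOfVars ι K • (⊤ : Submodule (MvPolynomial ι K) (MvPolynomial σ K)) := by
    refine Submodule.span_induction ?_ (zero_mem _) (fun _ _ _ _ ↦ add_mem) ?_ hx
    · rintro _ ⟨i, rfl⟩
      have := Submodule.smul_mem_smul
        (Ideal.subset_span (Set.mem_range_self i) : X i ∈ idealOfVars ι K)
        (Submodule.mem_top : (1 : MvPolynomial σ K) ∈ (⊤ : Submodule (MvPolynomial ι K) _))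
      rwa [Algebra.smul_def, mul_one, hmapX] at this
    · intro a x _ hx
      refine Submodule.smul_induction_on hx (fun r hr y _ ↦ ?_) fun y z hy hz ↦ ?_
      · rw [smul_comm]
        exact Submodule.smul_mem_smul hr Submodule.mem_top
      · rw [smul_add]
        exact add_mem hy hz
  have hspan : Submodule.span (MvPolynomial ι K) (Set.range b) ⊔ idealOfVars ι K • ⊤ = ⊤ := by
    refine eq_top_iff.2 fun x _ ↦ ?_
    obtain ⟨a, ha⟩ := (Submodule.mem_span_range_iff_exists_fun K).1
      (hv ▸ Submodule.mem_top : Ideal.Quotient.mk I x ∈ Submodule.span K (Set.range v))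
    rw [← add_sub_cancel (∑ i, a i • b i) x]
    refine add_mem (Submodule.mem_sup_left ?_) (Submodule.mem_sup_right (hI _ ?_))
    · refine Submodule.sum_mem _ fun i _ ↦ ?_
      rw [← algebraMap_smul (MvPolynomial ι K)]
      exact Submodule.smul_mem _ _ (Submodule.subset_span (Set.mem_range_self i))
    · rw [← Ideal.Quotient.eq, ← ha, ← Ideal.Quotient.mkₐ_eq_mk K, map_sum]
      simp [hb]
  obtain ⟨s, hs, c, hc0, hc⟩ := exists_linearIndepOn_smul_mem_span
    (R := MvPolynomial ι K) b
  obtain ⟨m, hm⟩ := exists_mem_pow_idealOfVars_of_mul_mem hc0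
  refine le_trans ?_ (card_le_prod_of_linearIndependent e hd (fun i ↦ by rw [hmapX]; exact hF i) hs)
  rw [← add_le_add_iff_right n]
  refine le_of_mul_monomialCount_le ι (c := m) fun N ↦ ?_
  have h := finrank_add_le_of_span_sup_eq_top hspan hc hm N
    (taylorCoeff (Subtype.val : Z → σ → K) (N + m)) (taylorCoeff_surjective Subtype.val_injective _)
    fun g hg x ↦ taylorCoeff_smul_eq_zero (fun j i ↦ by rw [hmapX]; exact j.2 i) hg x
  rw [Module.finrank_pi_fintype, Finset.sum_const, finrank_truncCoeff, Finset.card_univ,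
    ← Nat.card_eq_fintype_card, Nat.card_coe_set_eq, smul_eq_mul, Fintype.card_fin,
    ← monomialCount_congr e] at h
  refine le_trans ?_ h
  rw [add_mul]
  gcongr
  exact monomialCount_mono ι (Nat.le_add_right N m)

end Bezout

lemma map_gaussMoment {α β : Type*} [CommRing α] [CommRing β] (f : α →+* β) (μ v : α) (i : ℕ) :
    f (gaussMoment i μ v) = gaussMoment i (f μ) (f v) := by
  induction i using Nat.twoStepInduction with
  | zero => simp [gaussMoment]
  | one => simp [gaussMoment]
  | more n h0 h1 => simp [gaussMoment, h0, h1]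

lemma totalDegree_gaussMoment_le {σ R : Type*} [CommRing R] {μ v : MvPolynomial σ R}
    (hμ : μ.totalDegree ≤ 1) (hv : v.totalDegree ≤ 2) (i : ℕ) :
    (gaussMoment i μ v).totalDegree ≤ i := by
  induction i using Nat.twoStepInduction with
  | zero => simp [gaussMoment]
  | one => simpa [gaussMoment] using hμ
  | more n h0 h1 =>
    have hn : ((n : MvPolynomial σ R) + 1).totalDegree = 0 := by
      rw [← totalDegree_C (σ := σ) ((n : R) + 1)]; simp
    refine (totalDegree_add _ _).trans (max_le ?_ ?_)
    · have := totalDegree_mul μ (gaussMoment (n + 1) μ v)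
      omega
    · have h2 := totalDegree_mul (((n : MvPolynomial σ R) + 1) * v) (gaussMoment n μ v)
      have h3 := totalDegree_mul ((n : MvPolynomial σ R) + 1) v
      omega

/-- If the solution set of the λ-weighted homoscedastic Gaussian `k`-mixture moment system
given by the first `k+1` moments is finite, then it has at most `(k+1)!/2` elements. -/
theorem homoscedastic_solution_bound (k : ℕ) (hk : 1 ≤ k)
    (lam : Fin k → ℂ) (hlam : ∀ ℓ, lam ℓ ≠ 0) (m : Fin (k + 1) → ℂ)
    (S : Set ((Fin k → ℂ) × ℂ))
    (hS : S = {x | ∀ i : Fin (k + 1),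
      ∑ ℓ, lam ℓ * gaussMoment (i.1 + 1) (x.1 ℓ) x.2 = m i})
    (hfin : S.Finite) :
    Nat.card S ≤ (k + 1).factorial / 2 := by
  have := hfin.to_subtype
  obtain ⟨c, hc⟩ := (hfin.image Prod.snd).exists_notMem
  choose t ht using fun x : S ↦ IsAlgClosed.exists_pow_nat_eq (x.1.2 - c) two_pos
  have ht0 (x : S) : t x ≠ 0 := by
    intro h
    have hx := ht x
    rw [h, zero_pow two_ne_zero, eq_comm, sub_eq_zero] at hx
    exact hc (hx ▸ Set.mem_image_of_mem Prod.snd x.2)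
  let F (i : Fin (k + 1)) : MvPolynomial (Option (Fin k)) ℂ :=
    ∑ ℓ, C (lam ℓ) * gaussMoment (i.1 + 1) (X (some ℓ)) (X none ^ 2 + C c) - C (m i)
  let Z : Set (Option (Fin k) → ℂ) := {z | ∀ i, eval z (F i) = 0}
  have hZ (z : Option (Fin k) → ℂ) : z ∈ Z ↔ (fun ℓ ↦ z (some ℓ), z none ^ 2 + c) ∈ S := by
    simp [Z, F, hS, map_gaussMoment, sub_eq_zero]
  let ψ (q : S × Bool) : Option (Fin k) → ℂ :=
    fun o ↦ o.elim (if q.2 then t q.1 else -t q.1) q.1.1.1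
  have hψsq (q : S × Bool) : ψ q none ^ 2 = q.1.1.2 - c := by
    rw [← ht]
    by_cases h : q.2 <;> simp [ψ, h]
  have hψ : Function.Injective ψ := by
    rintro ⟨x, ε⟩ ⟨y, δ⟩ h
    have hxy : x = y := by
      refine Subtype.ext (Prod.ext (_root_.funext fun ℓ ↦ congrFun h (some ℓ)) ?_)
      have hsq : ψ (x, ε) none ^ 2 = ψ (y, δ) none ^ 2 := by rw [h]
      rw [hψsq, hψsq] at hsq
      exact sub_left_inj.1 hsq
    subst hxy
    have hnone := congrFun h none
    cases ε <;> cases δ <;> simp [ψ, self_eq_neg, neg_eq_self, ht0] at hnone ⊢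
  have hrange : Z = Set.range ψ := by
    ext z
    rw [hZ]
    constructor
    · intro hz
      have hsq := ht ⟨_, hz⟩
      rw [add_sub_cancel_right, sq_eq_sq_iff_eq_or_eq_neg] at hsq
      obtain h | h := hsq
      · refine ⟨(⟨_, hz⟩, true), _root_.funext fun o ↦ ?_⟩
        cases o <;> simp [ψ, h]
      · refine ⟨(⟨_, hz⟩, false), _root_.funext fun o ↦ ?_⟩
        cases o <;> simp [ψ, h]
    · rintro ⟨q, rfl⟩
      rw [hψsq, sub_add_cancel]
      exact q.1.2
  have hdeg (i : Fin (k + 1)) : (F i).totalDegree ≤ i.1 + 1 := by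
    refine (totalDegree_sub_C_le _ _).trans (totalDegree_finsetSum_le fun ℓ _ ↦ ?_)
    refine (totalDegree_mul _ _).trans ?_
    rw [totalDegree_C, zero_add]
    refine totalDegree_gaussMoment_le (totalDegree_X _).le ?_ _
    refine (totalDegree_add _ _).trans (max_le ?_ (by simp))
    simp
  have hZfin : Z.Finite := hrange ▸ Set.finite_range ψ
  have hcard := ncard_zeros_le_prod (finSuccEquiv k) F (d := fun i ↦ i.1 + 1)
    (fun i ↦ Nat.succ_pos _) hdeg hZfin
  change Z.ncard ≤ _ at hcard
  rw [hrange, ← Set.image_univ, Set.ncard_image_of_injective _ hψ, Set.ncard_univ, Nat.card_prod,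
    Nat.card_eq_fintype_card (α := Bool), Fintype.card_bool,
    Fin.prod_univ_eq_prod_range (fun i ↦ i + 1), Finset.prod_range_add_one_eq_factorial] at hcard
  exact (Nat.le_div_iff_mul_le two_pos).2 hcard
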